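/- Let g be in normal form and let ν₀ = (0, y₀, z₀) ∈ ℝ³ be a unit vector. Then the height function h_{ν₀} has an A₂ singularity at (0,0) if and only if one of the following holds: (2a) b₂ y₀ + a_{2,0} z₀ = 0, y₀ ≠ 0 and b₃ y₀ + a_{3,0} z₀ ≠ 0; or (2b) y₀ = 0, a_{2,0} ≠ 0 and a_{0,3} ≠ 0. -/

import Mathlib

open Real Set

noncomputable section

/-- Partial derivative in the first variable. -/
def pdu {F : Type*} [NormedAddCommGroup F] [NormedSpace ℝ F] (f : ℝ → ℝ → F) : ℝ → ℝ → F :=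
  fun u w => deriv (fun t => f t w) u

/-- Partial derivative in the second variable. -/
def pdw {F : Type*} [NormedAddCommGroup F] [NormedSpace ℝ F] (f : ℝ → ℝ → F) : ℝ → ℝ → F :=
  fun u w => deriv (fun t => f u t) w

/-- Iterated partial derivative `∂_u^i ∂_w^j f`. -/
def pd {F : Type*} [NormedAddCommGroup F] [NormedSpace ℝ F] (i j : ℕ) (f : ℝ → ℝ → F) :
    ℝ → ℝ → F :=
  pdu^[i] (pdw^[j] f)

/-- The Euclidean inner product on `ℝ³ = ℝ × ℝ × ℝ`. -/
def dot3 (x y : ℝ × ℝ × ℝ) : ℝ := x.1 * y.1 + x.2.1 * y.2.1 + x.2.2 * y.2.2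

/-- The cross product on `ℝ³ = ℝ × ℝ × ℝ`. -/
def cross3 (x y : ℝ × ℝ × ℝ) : ℝ × ℝ × ℝ :=
  (x.2.1 * y.2.2 - x.2.2 * y.2.1, x.2.2 * y.1 - x.1 * y.2.2, x.1 * y.2.1 - x.2.1 * y.1)

/-- The Euclidean norm on `ℝ³ = ℝ × ℝ × ℝ`. -/
def norm3 (x : ℝ × ℝ × ℝ) : ℝ := Real.sqrt (dot3 x x)

/-- The surface parameterization `g(u,w) = (u, p(u,w), q(u,w))`. -/
def gmap (p q : ℝ → ℝ → ℝ) : ℝ → ℝ → ℝ × ℝ × ℝ := fun u w => (u, p u w, q u w)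

/-- The height function on the surface parameterized by `g = (u, p, q)` along `v`. -/
def hgt (p q : ℝ → ℝ → ℝ) (v : ℝ × ℝ × ℝ) : ℝ → ℝ → ℝ :=
  fun u w => dot3 (gmap p q u w) v

/-- `g = (u, p(u,w), q(u,w))` is in normal form of order `N`. -/
def NormalFormN (N : ℕ) (p q : ℝ → ℝ → ℝ) (b : ℕ → ℝ) (a : ℕ → ℕ → ℝ) : Prop :=
  ContDiff ℝ (⊤ : ℕ∞) (fun x : ℝ × ℝ => p x.1 x.2) ∧
  ContDiff ℝ (⊤ : ℕ∞) (fun x : ℝ × ℝ => q x.1 x.2) ∧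
  p 0 0 = 0 ∧ q 0 0 = 0 ∧
  pd 1 0 p 0 0 = 0 ∧ pd 0 1 p 0 0 = 0 ∧ pd 1 0 q 0 0 = 0 ∧ pd 0 1 q 0 0 = 0 ∧
  pd 0 2 p 0 0 = 1 ∧
  (∀ i, 2 ≤ i → i ≤ N → pd i 0 p 0 0 = b i) ∧
  (∀ i j, 2 ≤ i + j → i + j ≤ N → 1 ≤ j → ¬(i = 0 ∧ j = 2) → pd i j p 0 0 = 0) ∧
  (∀ i j, 2 ≤ i + j → i + j ≤ N → pd i j q 0 0 = a i j) ∧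
  a 1 1 = 0 ∧ a 0 2 = 0

/-- `h` has an `A_k` singularity at the origin: up to a `C^∞` change of coordinates fixing
the origin, `h` equals `h(0,0) ± x² ± y^(k+1)`. -/
def HasAkSingAt (h : ℝ → ℝ → ℝ) (k : ℕ) : Prop :=
  ∃ (U V : Set (ℝ × ℝ)) (φ ψ : ℝ × ℝ → ℝ × ℝ) (ε₁ ε₂ : ℝ),
    IsOpen U ∧ IsOpen V ∧ ((0, 0) : ℝ × ℝ) ∈ U ∧ ((0, 0) : ℝ × ℝ) ∈ V ∧
    ContDiffOn ℝ (⊤ : ℕ∞) φ U ∧ ContDiffOn ℝ (⊤ : ℕ∞) ψ V ∧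
    Set.MapsTo φ U V ∧ Set.MapsTo ψ V U ∧
    (∀ x ∈ U, ψ (φ x) = x) ∧ (∀ y ∈ V, φ (ψ y) = y) ∧
    φ (0, 0) = (0, 0) ∧ (ε₁ = 1 ∨ ε₁ = -1) ∧ (ε₂ = 1 ∨ ε₂ = -1) ∧
    ∀ x ∈ U, h (φ x).1 (φ x).2 = h 0 0 + ε₁ * x.1 ^ 2 + ε₂ * x.2 ^ (k + 1)

/-- The parabolic-set function `Σ = ⟨g_uu, g_u × g_w⟩⟨g_ww, g_u × g_w⟩ − ⟨g_uw, g_u × g_w⟩²`. -/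
def SigmaFun (p q : ℝ → ℝ → ℝ) : ℝ → ℝ → ℝ := fun u w =>
  dot3 (pd 2 0 (gmap p q) u w) (cross3 (pd 1 0 (gmap p q) u w) (pd 0 1 (gmap p q) u w)) *
      dot3 (pd 0 2 (gmap p q) u w) (cross3 (pd 1 0 (gmap p q) u w) (pd 0 1 (gmap p q) u w)) -
    dot3 (pd 1 1 (gmap p q) u w) (cross3 (pd 1 0 (gmap p q) u w) (pd 0 1 (gmap p q) u w)) ^ 2

/-- The torsion of a space curve `L`. -/
def tor (L : ℝ → ℝ × ℝ × ℝ) : ℝ → ℝ := fun t =>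
  dot3 (cross3 (deriv L t) (deriv (deriv L) t)) (deriv (deriv (deriv L)) t) /
    norm3 (cross3 (deriv L t) (deriv (deriv L) t)) ^ 2

/-- The unit binormal vector of a space curve `L` at `t = 0`. -/
def binormal0 (L : ℝ → ℝ × ℝ × ℝ) : ℝ × ℝ × ℝ :=
  (norm3 (cross3 (deriv L 0) (deriv (deriv L) 0)))⁻¹ • cross3 (deriv L 0) (deriv (deriv L) 0)

/-- `f` is a parabolic Monge form with `∂_w² f(0,0) = k₂ ≠ 0`. -/
def MongeForm (f : ℝ → ℝ → ℝ) (k₂ : ℝ) : Prop :=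
  ContDiff ℝ (⊤ : ℕ∞) (fun x : ℝ × ℝ => f x.1 x.2) ∧ f 0 0 = 0 ∧
  pd 1 0 f 0 0 = 0 ∧ pd 0 1 f 0 0 = 0 ∧
  pd 2 0 f 0 0 = 0 ∧ pd 1 1 f 0 0 = 0 ∧ pd 0 2 f 0 0 = k₂ ∧ k₂ ≠ 0

/-- The parabolic-set function `P = f_uu f_ww − f_uw²` of a Monge form. -/
def Pfun (f : ℝ → ℝ → ℝ) : ℝ → ℝ → ℝ := fun u w =>
  pd 2 0 f u w * pd 0 2 f u w - pd 1 1 f u w ^ 2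

theorem contDiff_integral_param {E F : Type} [NormedAddCommGroup E] [NormedSpace ℝ E]
    [ProperSpace E] [NormedAddCommGroup F] [NormedSpace ℝ F] {f : E × ℝ → F}
    (hf : ContDiff ℝ (⊤ : ℕ∞) f) :
    ContDiff ℝ (⊤ : ℕ∞) (fun x => ∫ t in (0 : ℝ)..1, f (x, t)) := by
  rw [contDiff_infty]
  intro n
  induction n generalizing F with
  | zero =>
    refine contDiff_zero.2 ?_
    exact intervalIntegral.continuous_parametric_intervalIntegral_of_continuous'
      (f := fun x t => f (x, t)) hf.continuous 0 1
  | succ n ih =>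
    have hfd : ContDiff ℝ (⊤ : ℕ∞) (fderiv ℝ f) := hf.fderiv_right (by simp)
    have hG : ContDiff ℝ (⊤ : ℕ∞)
        (fun z => (fderiv ℝ f z).comp (ContinuousLinearMap.inl ℝ E ℝ)) :=
      hfd.clm_comp contDiff_const
    refine contDiff_succ_iff_hasFDerivAt.2 ⟨_, ih hG, fun x₀ => ?_⟩
    obtain ⟨C, hC⟩ := ((isCompact_closedBall x₀ 1).prod
      (isCompact_Icc (a := (0 : ℝ)) (b := 1))).exists_bound_of_continuousOn hG.continuous.continuousOn
    refine intervalIntegral.hasFDerivAt_integral_of_dominated_of_fderiv_le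
      (F := fun x t => f (x, t)) (bound := fun _ => C)
      (F' := fun x t => (fderiv ℝ f (x, t)).comp (ContinuousLinearMap.inl ℝ E ℝ))
      (Metric.closedBall_mem_nhds x₀ one_pos) ?_ ?_ ?_ ?_ ?_ ?_
    · exact .of_forall fun x =>
        (hf.continuous.comp (Continuous.prodMk_right x)).aestronglyMeasurable
    · exact (hf.continuous.comp (Continuous.prodMk_right x₀)).intervalIntegrable _ _
    · exact (hG.continuous.comp (Continuous.prodMk_right x₀)).aestronglyMeasurable
    · refine .of_forall fun t ht x hx => hC (x, t) ⟨hx, ?_⟩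
      rw [uIoc_of_le zero_le_one] at ht
      exact Ioc_subset_Icc_self ht
    · exact intervalIntegrable_const
    · refine .of_forall fun t _ x _ => ?_
      exact (hf.differentiable (by simp) (x, t)).hasFDerivAt.comp x (hasFDerivAt_prodMk_left x t)

/-- Joint smoothness of a curried function of two real variables. -/
def Smooth₂ (f : ℝ → ℝ → ℝ) : Prop := ContDiff ℝ (⊤ : ℕ∞) (fun x : ℝ × ℝ => f x.1 x.2)

namespace Smooth₂

variable {f g : ℝ → ℝ → ℝ}

theorem hasDerivAt_fst (hf : Smooth₂ f) (u w : ℝ) :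
    HasDerivAt (fun t => f t w) (fderiv ℝ (fun x : ℝ × ℝ => f x.1 x.2) (u, w) (1, 0)) u :=
  HasFDerivAt.comp_hasDerivAt (f := fun t : ℝ => (t, w)) u
    (hf.differentiable (by simp) (u, w)).hasFDerivAt ((hasDerivAt_id u).prodMk (hasDerivAt_const u w))

theorem hasDerivAt_snd (hf : Smooth₂ f) (u w : ℝ) :
    HasDerivAt (fun t => f u t) (fderiv ℝ (fun x : ℝ × ℝ => f x.1 x.2) (u, w) (0, 1)) w :=
  HasFDerivAt.comp_hasDerivAt (f := fun t : ℝ => (u, t)) w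
    (hf.differentiable (by simp) (u, w)).hasFDerivAt ((hasDerivAt_const w u).prodMk (hasDerivAt_id w))

theorem hasDerivAt_pdu (hf : Smooth₂ f) (u w : ℝ) :
    HasDerivAt (fun t => f t w) (pdu f u w) u :=
  (hf.hasDerivAt_fst u w).differentiableAt.hasDerivAt

theorem hasDerivAt_pdw (hf : Smooth₂ f) (u w : ℝ) :
    HasDerivAt (fun t => f u t) (pdw f u w) w :=
  (hf.hasDerivAt_snd u w).differentiableAt.hasDerivAt

theorem smooth_pdu (hf : Smooth₂ f) : Smooth₂ (pdu f) := by
  have h : ContDiff ℝ (⊤ : ℕ∞)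
      (fun z => fderiv ℝ (fun x : ℝ × ℝ => f x.1 x.2) z (1, 0)) :=
    (ContDiff.fderiv_right hf (by simp)).clm_apply contDiff_const
  have e : (fun z : ℝ × ℝ => pdu f z.1 z.2) = _ := funext fun z => (hf.hasDerivAt_fst z.1 z.2).deriv
  rw [Smooth₂, e]
  exact h

theorem smooth_pdw (hf : Smooth₂ f) : Smooth₂ (pdw f) := by
  have h : ContDiff ℝ (⊤ : ℕ∞)
      (fun z => fderiv ℝ (fun x : ℝ × ℝ => f x.1 x.2) z (0, 1)) :=
    (ContDiff.fderiv_right hf (by simp)).clm_apply contDiff_const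
  have e : (fun z : ℝ × ℝ => pdw f z.1 z.2) = _ := funext fun z => (hf.hasDerivAt_snd z.1 z.2).deriv
  rw [Smooth₂, e]
  exact h

theorem smooth_pd (hf : Smooth₂ f) (i j : ℕ) : Smooth₂ (pd i j f) := by
  have h : Smooth₂ (pdw^[j] f) := by
    induction j with
    | zero => exact hf
    | succ j ih => rw [Function.iterate_succ_apply']; exact ih.smooth_pdw
  unfold pd
  induction i with
  | zero => exact h
  | succ i ih => rw [Function.iterate_succ_apply']; exact ih.smooth_pdu

theorem swap (hf : Smooth₂ f) : Smooth₂ (fun u w => f w u) :=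
  ContDiff.comp (g := fun x : ℝ × ℝ => f x.1 x.2) hf (contDiff_snd.prodMk contDiff_fst)

theorem comp_fst (hf : Smooth₂ f) (w : ℝ) : ContDiff ℝ (⊤ : ℕ∞) (fun u => f u w) :=
  ContDiff.comp (g := fun x : ℝ × ℝ => f x.1 x.2) hf (contDiff_id.prodMk contDiff_const)

theorem comp_snd (hf : Smooth₂ f) (u : ℝ) : ContDiff ℝ (⊤ : ℕ∞) (f u) :=
  ContDiff.comp (g := fun x : ℝ × ℝ => f x.1 x.2) hf (contDiff_const.prodMk contDiff_id)

theorem linear_comb (hf : Smooth₂ f) (hg : Smooth₂ g) (c d : ℝ) :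
    Smooth₂ (fun u w => c * f u w + d * g u w) :=
  ContDiff.add (contDiff_const.mul hf) (contDiff_const.mul hg)

theorem pdu_linear_comb (hf : Smooth₂ f) (hg : Smooth₂ g) (c d : ℝ) :
    pdu (fun u w => c * f u w + d * g u w) = fun u w => c * pdu f u w + d * pdu g u w := by
  ext u w
  exact (((hf.hasDerivAt_pdu u w).const_mul c).add ((hg.hasDerivAt_pdu u w).const_mul d)).deriv

theorem pdw_linear_comb (hf : Smooth₂ f) (hg : Smooth₂ g) (c d : ℝ) :
    pdw (fun u w => c * f u w + d * g u w) = fun u w => c * pdw f u w + d * pdw g u w := by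
  ext u w
  exact (((hf.hasDerivAt_pdw u w).const_mul c).add ((hg.hasDerivAt_pdw u w).const_mul d)).deriv

theorem pd_linear_comb (hf : Smooth₂ f) (hg : Smooth₂ g) (c d : ℝ) (i j : ℕ) :
    pd i j (fun u w => c * f u w + d * g u w) =
      fun u w => c * pd i j f u w + d * pd i j g u w := by
  induction i with
  | zero =>
    induction j with
    | zero => rfl
    | succ j ih =>
      simp only [pd, Function.iterate_zero, id] at ih ⊢
      simp only [Function.iterate_succ_apply']
      rw [ih]
      exact pdw_linear_comb (hf.smooth_pd 0 j) (hg.smooth_pd 0 j) c d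
  | succ i ih =>
    unfold pd at ih ⊢
    simp only [Function.iterate_succ_apply']
    rw [ih]
    exact pdu_linear_comb (hf.smooth_pd i j) (hg.smooth_pd i j) c d

/-- **Hadamard's lemma** in the second variable, with a smooth parameter. -/
theorem hadamard (hf : Smooth₂ f) :
    ∃ g, Smooth₂ g ∧ (∀ u w, f u w = f u 0 + w * g u w) ∧ ∀ u, g u 0 = pdw f u 0 := by
  refine ⟨fun u w => ∫ t in (0 : ℝ)..1, pdw f u (t * w), ?_, fun u w => ?_, fun u => by simp⟩
  · refine contDiff_integral_param (f := fun z : (ℝ × ℝ) × ℝ => pdw f z.1.1 (z.2 * z.1.2)) ?_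
    exact ContDiff.comp (g := fun x : ℝ × ℝ => pdw f x.1 x.2)
      (f := fun z : (ℝ × ℝ) × ℝ => (z.1.1, z.2 * z.1.2)) hf.smooth_pdw (by fun_prop)
  · have hd : ∀ t ∈ uIcc (0 : ℝ) 1,
        HasDerivAt (fun t => f u (t * w)) (pdw f u (t * w) * w) t := fun t _ =>
      (hf.hasDerivAt_pdw u (t * w)).comp t (by simpa using (hasDerivAt_id t).mul_const w)
    have hc : Continuous fun t : ℝ => pdw f u (t * w) * w :=
      ((hf.smooth_pdw.comp_snd u).continuous.comp (by fun_prop)).mul continuous_const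
    have := intervalIntegral.integral_eq_sub_of_hasDerivAt hd (hc.intervalIntegrable _ _)
    rw [intervalIntegral.integral_mul_const] at this
    simp only [one_mul, zero_mul] at this
    linarith

end Smooth₂

theorem pdu_iterate (f : ℝ → ℝ → ℝ) (i : ℕ) (u w : ℝ) :
    pdu^[i] f u w = iteratedDeriv i (fun t => f t w) u := by
  induction i generalizing u with
  | zero => simp
  | succ i ih =>
    rw [Function.iterate_succ_apply', iteratedDeriv_succ]
    exact congrArg (fun k => deriv k u) (funext ih)

theorem pdw_iterate (f : ℝ → ℝ → ℝ) (i : ℕ) (u w : ℝ) :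
    pdw^[i] f u w = iteratedDeriv i (f u) w := by
  induction i generalizing w with
  | zero => simp
  | succ i ih =>
    rw [Function.iterate_succ_apply', iteratedDeriv_succ]
    exact congrArg (fun k => deriv k w) (funext ih)

theorem iteratedDeriv_succ_eq_of_hadamard {f g : ℝ → ℝ} (hg : ContDiff ℝ (⊤ : ℕ∞) g)
    (h : ∀ x, f x = f 0 + x * g x) (k : ℕ) :
    iteratedDeriv (k + 1) f 0 = (k + 1) * iteratedDeriv k g 0 := by
  have hg' : ∀ k x, HasDerivAt (iteratedDeriv k g) (iteratedDeriv (k + 1) g x) x := by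
    intro k x
    rw [iteratedDeriv_succ]
    exact (hg.differentiable_iteratedDeriv k (by exact_mod_cast ENat.natCast_lt_top k) x).hasDerivAt
  have key : ∀ x, iteratedDeriv (k + 1) f x =
      x * iteratedDeriv (k + 1) g x + (k + 1) * iteratedDeriv k g x := by
    induction k with
    | zero =>
      intro x
      rw [iteratedDeriv_one, funext h]
      have := (((hasDerivAt_id x).mul (hg' 0 x)).const_add (f 0)).deriv
      simp only [id, iteratedDeriv_zero] at this
      refine this.trans ?_
      simp
      ring
    | succ k ih =>
      intro x
      rw [iteratedDeriv_succ, funext ih]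
      have := (((hasDerivAt_id x).mul (hg' (k + 1) x)).add
        ((hg' k x).const_mul ((k : ℝ) + 1))).deriv
      refine this.trans ?_
      simp
      ring
  simpa using key 0

theorem ContDiff.hadamard {f : ℝ → ℝ} (hf : ContDiff ℝ (⊤ : ℕ∞) f) :
    ∃ g, ContDiff ℝ (⊤ : ℕ∞) g ∧ ∀ x, f x = f 0 + x * g x := by
  have hf' : Smooth₂ fun _ w => f w := ContDiff.comp hf contDiff_snd
  obtain ⟨g, hg, h, -⟩ := hf'.hadamard
  exact ⟨g 0, hg.comp_snd 0, h 0⟩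

theorem eventuallyEq_pdu {f g : ℝ → ℝ → ℝ} {z : ℝ × ℝ}
    (h : ∀ᶠ x in nhds z, f x.1 x.2 = g x.1 x.2) :
    ∀ᶠ x in nhds z, pdu f x.1 x.2 = pdu g x.1 x.2 := by
  filter_upwards [h.eventually_nhds] with x hx
  refine Filter.EventuallyEq.deriv_eq ?_
  exact ((Continuous.prodMk_left x.2).tendsto x.1).eventually hx

theorem eventuallyEq_pdw {f g : ℝ → ℝ → ℝ} {z : ℝ × ℝ}
    (h : ∀ᶠ x in nhds z, f x.1 x.2 = g x.1 x.2) :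
    ∀ᶠ x in nhds z, pdw f x.1 x.2 = pdw g x.1 x.2 := by
  filter_upwards [h.eventually_nhds] with x hx
  refine Filter.EventuallyEq.deriv_eq ?_
  exact ((Continuous.prodMk_right x.1).tendsto x.2).eventually hx

theorem pd_congr_of_eventuallyEq {f g : ℝ → ℝ → ℝ} {u w : ℝ}
    (h : ∀ᶠ x in nhds (u, w), f x.1 x.2 = g x.1 x.2) (i j : ℕ) :
    pd i j f u w = pd i j g u w := by
  have hj : ∀ᶠ x in nhds (u, w), pdw^[j] f x.1 x.2 = pdw^[j] g x.1 x.2 := by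
    induction j with
    | zero => exact h
    | succ j ih => simp only [Function.iterate_succ_apply']; exact eventuallyEq_pdw ih
  have hi : ∀ᶠ x in nhds (u, w), pd i j f x.1 x.2 = pd i j g x.1 x.2 := by
    unfold pd
    induction i with
    | zero => exact hj
    | succ i ih => simp only [Function.iterate_succ_apply']; exact eventuallyEq_pdu ih
  exact hi.self_of_nhds

theorem exists_contDiff_eventuallyEq {E F : Type*} [NormedAddCommGroup E] [NormedSpace ℝ E]
    [HasContDiffBump E] [FiniteDimensional ℝ E] [NormedAddCommGroup F] [NormedSpace ℝ F]
    {f : E → F} {V : Set E} {x : E}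
    (hV : IsOpen V) (hx : x ∈ V) (hf : ContDiffOn ℝ (⊤ : ℕ∞) f V) :
    ∃ g : E → F, ContDiff ℝ (⊤ : ℕ∞) g ∧ g =ᶠ[nhds x] f := by
  obtain ⟨r, hr, hrV⟩ := Metric.nhds_basis_closedBall.mem_iff.1 (hV.mem_nhds hx)
  let χ : ContDiffBump x := ⟨r / 2, r, by positivity, by linarith⟩
  refine ⟨fun y => χ y • f y, ?_, ?_⟩
  · refine contDiff_iff_contDiffAt.2 fun y => ?_
    by_cases hy : y ∈ tsupport fun y => χ y • f y
    swap
    · exact contDiffAt_const.congr_of_eventuallyEq (notMem_tsupport_iff_eventuallyEq.1 hy)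
    have hyV : y ∈ V := hrV (by
      have := tsupport_smul_subset_left (χ : E → ℝ) f hy
      rwa [χ.tsupport_eq] at this)
    exact χ.contDiffAt.smul (hf.contDiffAt (hV.mem_nhds hyV))
  · filter_upwards [χ.eventuallyEq_one] with y hy
    simp [hy]

theorem exists_openPartialHomeomorph_contDiffOn {E : Type*} [NormedAddCommGroup E]
    [NormedSpace ℝ E] [CompleteSpace E] {Ψ : E → E} {S : Set E} {x : E} (hS : IsOpen S)
    (hx : x ∈ S) (hΨ : ContDiffOn ℝ (⊤ : ℕ∞) Ψ S) {L : E ≃L[ℝ] E}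
    (hL : HasFDerivAt Ψ (L : E →L[ℝ] E) x) :
    ∃ e : OpenPartialHomeomorph E E, ⇑e = Ψ ∧ x ∈ e.source ∧ e.source ⊆ S ∧
      ContDiffOn ℝ (⊤ : ℕ∞) e.symm e.target := by
  have hT : IsOpen (S ∩ fderiv ℝ Ψ ⁻¹' range ((↑) : (E ≃L[ℝ] E) → E →L[ℝ] E)) :=
    (hΨ.continuousOn_fderiv_of_isOpen hS (by simp)).isOpen_inter_preimage hS
      ContinuousLinearEquiv.isOpen
  have hat : ContDiffAt ℝ (⊤ : ℕ∞) Ψ x := hΨ.contDiffAt (hS.mem_nhds hx)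
  let e := (hat.toOpenPartialHomeomorph Ψ hL (by simp)).restrOpen _ hT
  have hsrc : e.source ⊆ S ∩ fderiv ℝ Ψ ⁻¹' range ((↑) : (E ≃L[ℝ] E) → E →L[ℝ] E) :=
    fun y hy => hy.2
  refine ⟨e, rfl, ⟨hat.mem_toOpenPartialHomeomorph_source hL (by simp), hx, L, hL.fderiv.symm⟩,
    fun y hy => (hsrc hy).1, fun y hy => ContDiffAt.contDiffWithinAt ?_⟩
  obtain ⟨hyS, M, hM⟩ := hsrc (e.map_target hy)
  have hc : ContDiffAt ℝ (⊤ : ℕ∞) Ψ (e.symm y) := hΨ.contDiffAt (hS.mem_nhds hyS)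
  refine e.contDiffAt_symm hy (f₀' := M) ?_ hc
  rw [hM]
  exact (hc.differentiableAt (by simp)).hasFDerivAt

theorem HasFDerivAt.mul_of_eq_zero {E : Type*} [NormedAddCommGroup E] [NormedSpace ℝ E]
    {f g : E → ℝ} {f' : E →L[ℝ] ℝ} {x : E} (hf : HasFDerivAt f f' x) (hfx : f x = 0)
    (hg : DifferentiableAt ℝ g x) : HasFDerivAt (fun y => f y * g y) (g x • f') x := by
  have := hf.mul hg.hasFDerivAt
  rwa [hfx, zero_smul, zero_add] at this

theorem exists_sign_mul_pos {c : ℝ} (hc : c ≠ 0) : ∃ ε : ℝ, (ε = 1 ∨ ε = -1) ∧ 0 < ε * c := by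
  rcases hc.lt_or_gt with h | h
  · exact ⟨-1, Or.inr rfl, by linarith⟩
  · exact ⟨1, Or.inl rfl, by linarith⟩

theorem HasAkSingAt.of_coordinates {h X Y : ℝ → ℝ → ℝ} {S : Set (ℝ × ℝ)} {k : ℕ}
    {ε₁ ε₂ c d : ℝ} (hε₁ : ε₁ = 1 ∨ ε₁ = -1) (hε₂ : ε₂ = 1 ∨ ε₂ = -1) (hS : IsOpen S)
    (h0 : ((0, 0) : ℝ × ℝ) ∈ S)
    (hX : ContDiffOn ℝ (⊤ : ℕ∞) (fun z : ℝ × ℝ => X z.1 z.2) S)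
    (hY : ContDiffOn ℝ (⊤ : ℕ∞) (fun z : ℝ × ℝ => Y z.1 z.2) S)
    (hX0 : X 0 0 = 0) (hY0 : Y 0 0 = 0) (hc : c ≠ 0) (hd : d ≠ 0)
    (hX' : HasFDerivAt (fun z : ℝ × ℝ => X z.1 z.2) (c • ContinuousLinearMap.snd ℝ ℝ ℝ) (0, 0))
    (hY' : HasFDerivAt (fun z : ℝ × ℝ => Y z.1 z.2) (d • ContinuousLinearMap.fst ℝ ℝ ℝ) (0, 0))
    (hh : ∀ z ∈ S, h z.1 z.2 = h 0 0 + ε₁ * X z.1 z.2 ^ 2 + ε₂ * Y z.1 z.2 ^ (k + 1)) :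
    HasAkSingAt h k := by
  let A : (ℝ × ℝ) →L[ℝ] (ℝ × ℝ) :=
    (c • ContinuousLinearMap.snd ℝ ℝ ℝ).prod (d • ContinuousLinearMap.fst ℝ ℝ ℝ)
  let B : (ℝ × ℝ) →L[ℝ] (ℝ × ℝ) :=
    (d⁻¹ • ContinuousLinearMap.snd ℝ ℝ ℝ).prod (c⁻¹ • ContinuousLinearMap.fst ℝ ℝ ℝ)
  let L : (ℝ × ℝ) ≃L[ℝ] (ℝ × ℝ) := ContinuousLinearEquiv.equivOfInverse A B
    (fun z => by simp [A, B, hc, hd]) (fun z => by simp [A, B, hc, hd])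
  obtain ⟨e, he, he0, heS, hes⟩ := exists_openPartialHomeomorph_contDiffOn (L := L) hS h0
    (hX.prodMk hY) (hX'.prodMk hY')
  have heq : e (0, 0) = (0, 0) := by rw [he]; simp [hX0, hY0]
  refine ⟨e.target, e.source, e.symm, e, ε₁, ε₂, e.open_target, e.open_source, ?_, he0, hes, ?_,
    e.mapsTo_symm, e.mapsTo, fun x hx => e.right_inv hx, fun x hx => e.left_inv hx, ?_, hε₁, hε₂,
    fun x hx => ?_⟩
  · rw [← heq]; exact e.map_source he0
  · rw [he]; exact (hX.prodMk hY).mono heS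
  · conv_lhs => rw [← heq]
    exact e.left_inv he0
  · have h1 := e.right_inv hx
    rw [he] at h1
    rw [hh _ (heS (e.map_target hx)), ← congrArg Prod.fst h1, ← congrArg Prod.snd h1]

theorem HasAkSingAt.of_swap {h : ℝ → ℝ → ℝ} {k : ℕ} (H : HasAkSingAt (fun u w => h w u) k) :
    HasAkSingAt h k := by
  obtain ⟨U, V, φ, ψ, ε₁, ε₂, hU, hV, hU0, hV0, hφ, hψ, mφ, mψ, l, r, h0, hε₁, hε₂, hh⟩ := H
  refine ⟨U, Prod.swap ⁻¹' V, Prod.swap ∘ φ, ψ ∘ Prod.swap, ε₁, ε₂, hU,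
    hV.preimage continuous_swap, hU0, hV0, ?_, ?_, ?_, ?_, ?_, ?_, ?_, hε₁, hε₂, hh⟩
  · exact (contDiff_snd.prodMk contDiff_fst).comp_contDiffOn hφ
  · exact hψ.comp (contDiff_snd.prodMk contDiff_fst).contDiffOn fun _ => id
  · exact fun x hx => mφ hx
  · exact fun x hx => mψ hx
  · exact fun x hx => l x hx
  · intro y hy
    simp [r _ hy]
  · simp [h0]

/-- A quadratic-plus-cubic expansion with nonvanishing leading coefficients is an `A₂`
singularity: complete the square and extract the roots of the coefficients. -/
theorem hasAkSingAt_two_of_expansion {h K : ℝ → ℝ → ℝ} {m n : ℝ → ℝ} (hK : Smooth₂ K)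
    (hm : ContDiff ℝ (⊤ : ℕ∞) m) (hn : ContDiff ℝ (⊤ : ℕ∞) n) (hK0 : K 0 0 ≠ 0) (hm0 : m 0 ≠ 0)
    (hh : ∀ u w, h u w = h 0 0 + u ^ 3 * m u + w * (u ^ 2 * n u) + w ^ 2 * K u w) :
    HasAkSingAt h 2 := by
  obtain ⟨ε₁, hε₁, hKpos⟩ := exists_sign_mul_pos hK0
  obtain ⟨ε₂, hε₂, hmpos⟩ := exists_sign_mul_pos hm0
  let M : ℝ × ℝ → ℝ := fun z => ε₂ * (m z.1 - z.1 * n z.1 ^ 2 / (4 * K z.1 z.2))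
  have hK' : ContDiff ℝ (⊤ : ℕ∞) fun z : ℝ × ℝ => K z.1 z.2 := hK
  have hm' : ContDiff ℝ (⊤ : ℕ∞) fun z : ℝ × ℝ => m z.1 := hm.comp contDiff_fst
  have hn' : ContDiff ℝ (⊤ : ℕ∞) fun z : ℝ × ℝ => n z.1 := hn.comp contDiff_fst
  let S₁ : Set (ℝ × ℝ) := {z | 0 < ε₁ * K z.1 z.2}
  have hS₁ : IsOpen S₁ := isOpen_lt continuous_const (hK'.continuous.const_mul ε₁)
  have hKne : ∀ z ∈ S₁, K z.1 z.2 ≠ 0 := fun z hz => (mul_ne_zero_iff.1 (ne_of_gt hz)).2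
  have hM : ContDiffOn ℝ (⊤ : ℕ∞) M S₁ :=
    contDiffOn_const.mul (hm'.contDiffOn.sub (((contDiff_fst.mul (hn'.pow 2)).contDiffOn).div
      (contDiff_const.mul hK').contDiffOn fun z hz => mul_ne_zero four_ne_zero (hKne z hz)))
  let S : Set (ℝ × ℝ) := S₁ ∩ M ⁻¹' Ioi 0
  have hS : IsOpen S := hM.continuousOn.isOpen_inter_preimage hS₁ isOpen_Ioi
  have h0 : ((0, 0) : ℝ × ℝ) ∈ S := ⟨hKpos, by simpa [M] using hmpos⟩
  have hα : ContDiffOn ℝ (⊤ : ℕ∞) (fun z : ℝ × ℝ => exp (log (ε₁ * K z.1 z.2) / 2)) S :=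
    (((contDiff_const.mul hK').contDiffOn.log fun z hz => ne_of_gt hz.1).div_const 2).exp
  have hβ : ContDiffOn ℝ (⊤ : ℕ∞) (fun z : ℝ × ℝ => exp (log (M z) / 3)) S :=
    (((hM.mono inter_subset_left).log fun z hz => ne_of_gt hz.2).div_const 3).exp
  have hγ : ContDiffOn ℝ (⊤ : ℕ∞) (fun z : ℝ × ℝ => z.1 * n z.1 / (2 * K z.1 z.2)) S :=
    (contDiff_fst.mul hn').contDiffOn.div (contDiff_const.mul hK').contDiffOn
      fun z hz => mul_ne_zero two_ne_zero (hKne z hz.1)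
  have hdiff : ∀ {f : ℝ × ℝ → ℝ}, ContDiffOn ℝ (⊤ : ℕ∞) f S → DifferentiableAt ℝ f (0, 0) :=
    fun hf => (hf.contDiffAt (hS.mem_nhds h0)).differentiableAt (by simp)
  have hq : HasFDerivAt (fun z : ℝ × ℝ => z.2 + z.1 * (z.1 * n z.1 / (2 * K z.1 z.2)))
      (ContinuousLinearMap.snd ℝ ℝ ℝ) (0, 0) := by
    have := (hasFDerivAt_snd (𝕜 := ℝ) (p := ((0, 0) : ℝ × ℝ))).fun_add
      ((hasFDerivAt_fst (𝕜 := ℝ) (p := ((0, 0) : ℝ × ℝ))).mul_of_eq_zero rfl (hdiff hγ))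
    simpa only [zero_mul, zero_div, zero_smul, add_zero] using this
  refine HasAkSingAt.of_coordinates
    (X := fun u w => (w + u * (u * n u / (2 * K u w))) * exp (log (ε₁ * K u w) / 2))
    (Y := fun u w => u * exp (log (M (u, w)) / 3)) hε₁ hε₂ hS h0
    ((contDiff_snd.contDiffOn.add (contDiff_fst.contDiffOn.mul hγ)).mul hα)
    (contDiff_fst.contDiffOn.mul hβ) (by simp) (by simp) (exp_ne_zero _) (exp_ne_zero _)
    (hq.mul_of_eq_zero (by simp) (hdiff hα)) (hasFDerivAt_fst.mul_of_eq_zero rfl (hdiff hβ)) ?_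
  rintro ⟨u, w⟩ hz
  have hKz : K u w ≠ 0 := hKne _ hz.1
  have e₁ : exp (log (ε₁ * K u w) / 2) ^ 2 = ε₁ * K u w := by
    rw [← exp_nat_mul, Nat.cast_ofNat, mul_div_cancel₀ _ two_ne_zero, exp_log hz.1]
  have e₂ : exp (log (M (u, w)) / 3) ^ 3 = M (u, w) := by
    rw [← exp_nat_mul, Nat.cast_ofNat, mul_div_cancel₀ _ three_ne_zero, exp_log hz.2]
  have s₁ : ε₁ * ε₁ = 1 := by rcases hε₁ with h | h <;> simp [h]
  have s₂ : ε₂ * ε₂ = 1 := by rcases hε₂ with h | h <;> simp [h]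
  simp only [mul_pow, Nat.reduceAdd, e₁, e₂, M]
  rw [hh u w]
  have r₁ : ∀ a b : ℝ, ε₁ * (a * (ε₁ * b)) = a * b := fun a b => by
    linear_combination a * b * s₁
  have r₂ : ∀ a b : ℝ, ε₂ * (a * (ε₂ * b)) = a * b := fun a b => by
    linear_combination a * b * s₂
  rw [r₁, r₂]
  field_simp
  ring

theorem ContDiff.hadamard_sq {f : ℝ → ℝ} (hf : ContDiff ℝ (⊤ : ℕ∞) f) (h0 : f 0 = 0)
    (h1 : deriv f 0 = 0) : ∃ n, ContDiff ℝ (⊤ : ℕ∞) n ∧ ∀ x, f x = x ^ 2 * n x := by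
  obtain ⟨g, hg, hfg⟩ := hf.hadamard
  obtain ⟨n, hn, hgn⟩ := hg.hadamard
  have hg0 := iteratedDeriv_succ_eq_of_hadamard hg hfg 0
  simp only [zero_add, iteratedDeriv_one, iteratedDeriv_zero, h1] at hg0
  refine ⟨n, hn, fun x => ?_⟩
  rw [hfg, hgn, h0, show g 0 = 0 by simpa using hg0.symm]
  ring

theorem ContDiff.hadamard_cube {f : ℝ → ℝ} (hf : ContDiff ℝ (⊤ : ℕ∞) f)
    (h1 : deriv f 0 = 0) (h2 : iteratedDeriv 2 f 0 = 0) :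
    ∃ m, ContDiff ℝ (⊤ : ℕ∞) m ∧ (∀ x, f x = f 0 + x ^ 3 * m x) ∧
      iteratedDeriv 3 f 0 = 6 * m 0 := by
  obtain ⟨g, hg, hfg⟩ := hf.hadamard
  obtain ⟨k, hk, hgk⟩ := hg.hadamard
  obtain ⟨m, hm, hkm⟩ := hk.hadamard
  have f1 := iteratedDeriv_succ_eq_of_hadamard hg hfg 0
  have f2 := iteratedDeriv_succ_eq_of_hadamard hg hfg 1
  have f3 := iteratedDeriv_succ_eq_of_hadamard hg hfg 2
  have g1 := iteratedDeriv_succ_eq_of_hadamard hk hgk 0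
  have g2 := iteratedDeriv_succ_eq_of_hadamard hk hgk 1
  have k1 := iteratedDeriv_succ_eq_of_hadamard hm hkm 0
  norm_num [h1, h2] at f1 f2 f3 g1 g2 k1
  refine ⟨m, hm, fun x => ?_, by rw [f3, g2, k1]; ring⟩
  have hg0 : g 0 = 0 := f1.symm
  have hk0 : k 0 = 0 := by rw [← g1]; exact f2
  rw [hfg, hgk, hkm, hg0, hk0]
  ring

theorem pd_iteratedDeriv_fst (f : ℝ → ℝ → ℝ) (i : ℕ) (u w : ℝ) :
    pd i 0 f u w = iteratedDeriv i (fun t => f t w) u := pdu_iterate f i u w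

theorem pd_iteratedDeriv_snd (f : ℝ → ℝ → ℝ) (i : ℕ) (u w : ℝ) :
    pd 0 i f u w = iteratedDeriv i (f u) w := pdw_iterate f i u w

theorem pd_fst_swap (f : ℝ → ℝ → ℝ) (i : ℕ) (u w : ℝ) :
    pd i 0 (fun u w => f w u) u w = pd 0 i f w u :=
  (pd_iteratedDeriv_fst _ i u w).trans (pd_iteratedDeriv_snd f i w u).symm

theorem pd_snd_swap (f : ℝ → ℝ → ℝ) (i : ℕ) (u w : ℝ) :
    pd 0 i (fun u w => f w u) u w = pd i 0 f w u :=
  (pd_iteratedDeriv_snd _ i u w).trans (pd_iteratedDeriv_fst f i w u).symm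

theorem hasAkSingAt_two_of_pd {h : ℝ → ℝ → ℝ} (hs : Smooth₂ h) (h10 : pd 1 0 h 0 0 = 0)
    (h01 : pd 0 1 h 0 0 = 0) (h20 : pd 2 0 h 0 0 = 0) (h11 : pd 1 1 h 0 0 = 0)
    (h02 : pd 0 2 h 0 0 ≠ 0) (h30 : pd 3 0 h 0 0 ≠ 0) : HasAkSingAt h 2 := by
  obtain ⟨g, hg, hhg, hg0⟩ := hs.hadamard
  obtain ⟨K, hK, hgK, -⟩ := hg.hadamard
  rw [pd_iteratedDeriv_fst] at h10 h20 h30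
  rw [pd_iteratedDeriv_snd] at h02
  rw [iteratedDeriv_one] at h10
  obtain ⟨m, hm, hhm, hm0⟩ := (hs.comp_fst 0).hadamard_cube h10 h20
  obtain ⟨n, hn, hgn⟩ := (hg.comp_fst 0).hadamard_sq ((hg0 0).trans h01)
    (by rw [funext hg0]; exact h11)
  refine hasAkSingAt_two_of_expansion hK hm hn ?_ ?_ fun u w => ?_
  · have e₁ := iteratedDeriv_succ_eq_of_hadamard (hg.comp_snd 0) (hhg 0) 1
    have e₂ := iteratedDeriv_succ_eq_of_hadamard (hK.comp_snd 0) (hgK 0) 0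
    norm_num at e₁ e₂
    rw [e₁, e₂] at h02
    exact right_ne_zero_of_mul h02
  · rw [hm0] at h30
    exact right_ne_zero_of_mul h30
  · rw [hhg, hgK, hhm, hgn]
    ring

theorem pd_one_one_swap {f : ℝ → ℝ → ℝ} (hf : Smooth₂ f) :
    pd 1 1 (fun u w => f w u) 0 0 = pd 1 1 f 0 0 := by
  obtain ⟨g, hg, hfg, hg0⟩ := hf.hadamard
  have e₁ : pd 1 1 f 0 0 = pdu g 0 0 := by
    change deriv (fun t => pdw f t 0) 0 = deriv (fun t => g t 0) 0
    rw [funext hg0]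
  have e₂ : ∀ w, pdu f 0 w = pdu f 0 0 + w * pdu g 0 w := fun w => by
    refine HasDerivAt.deriv ?_
    have := (hf.hasDerivAt_pdu 0 0).add ((hg.hasDerivAt_pdu 0 w).const_mul w)
    exact this.congr_of_eventuallyEq (.of_forall fun t => hfg t w)
  have e₃ := iteratedDeriv_succ_eq_of_hadamard (hg.smooth_pdu.comp_snd 0) e₂ 0
  norm_num at e₃
  rw [e₁, ← e₃]
  rfl

/-- The low-order derivatives of a function with an `A₂` singularity, in terms of the linear parts
`xu du + xw dw` and `yu du + yw dw` of its normalizing coordinates. -/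
theorem HasAkSingAt.exists_pd {h : ℝ → ℝ → ℝ} (H : HasAkSingAt h 2) :
    ∃ ε₁ ε₂ xu xw yu yw : ℝ, ε₁ ≠ 0 ∧ ε₂ ≠ 0 ∧ xu * yw - xw * yu ≠ 0 ∧
      pd 2 0 h 0 0 = 2 * ε₁ * xu ^ 2 ∧ pd 1 1 h 0 0 = 2 * ε₁ * (xu * xw) ∧
      pd 0 2 h 0 0 = 2 * ε₁ * xw ^ 2 ∧ (xu = 0 → pd 3 0 h 0 0 = 6 * ε₂ * yu ^ 3) ∧
      (xw = 0 → pd 0 3 h 0 0 = 6 * ε₂ * yw ^ 3) := by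
  obtain ⟨U, V, φ, ψ, ε₁, ε₂, hU, hV, hU0, hV0, hφ, hψ, mφ, mψ, l, r, h0, hε₁, hε₂, hh⟩ := H
  have hψ0 : ψ (0, 0) = (0, 0) := by
    have := l _ hU0
    rwa [h0] at this
  obtain ⟨Ψ, hΨ, hΨψ⟩ := exists_contDiff_eventuallyEq hV hV0 hψ
  let X : ℝ → ℝ → ℝ := fun u w => (Ψ (u, w)).1
  let Y : ℝ → ℝ → ℝ := fun u w => (Ψ (u, w)).2
  have hX : Smooth₂ X := contDiff_fst.comp hΨ
  have hY : Smooth₂ Y := contDiff_snd.comp hΨ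
  have hΨ0 : Ψ (0, 0) = (0, 0) := hΨψ.self_of_nhds.trans hψ0
  have hX0 : X 0 0 = 0 := congrArg Prod.fst hΨ0
  have hY0 : Y 0 0 = 0 := congrArg Prod.snd hΨ0
  have hpd : ∀ i j, pd i j h 0 0 =
      pd i j (fun u w => h 0 0 + ε₁ * X u w ^ 2 + ε₂ * Y u w ^ 3) 0 0 := by
    refine pd_congr_of_eventuallyEq ?_
    filter_upwards [hΨψ, hV.mem_nhds hV0] with x hx hxV
    have := hh _ (mψ hxV)
    rw [r x hxV, ← hx] at this
    exact this
  have hdet : pdu X 0 0 * pdw Y 0 0 - pdw X 0 0 * pdu Y 0 0 ≠ 0 := by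
    have dφ := ((hφ.contDiffAt (hU.mem_nhds hU0)).differentiableAt (by simp)).hasFDerivAt
    have dΨ := (hΨ.differentiable (by simp) (0, 0)).hasFDerivAt
    have hcomp : HasFDerivAt (Ψ ∘ φ) (ContinuousLinearMap.id ℝ (ℝ × ℝ)) (0, 0) := by
      refine (hasFDerivAt_id (0, 0)).congr_of_eventuallyEq ?_
      have hc : Filter.Tendsto φ (nhds (0, 0)) (nhds (0, 0)) := by
        simpa [ContinuousAt, h0] using dφ.continuousAt
      filter_upwards [hc.eventually hΨψ, hU.mem_nhds hU0] with x hx hxU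
      exact hx.trans (l x hxU)
    have hinv := HasFDerivAt.unique (HasFDerivAt.comp (0, 0) (by rw [h0]; exact dΨ) dφ) hcomp
    set R := fderiv ℝ φ (0, 0)
    set D := fderiv ℝ Ψ (0, 0)
    have hD : ∀ v : ℝ × ℝ, D v = (v.1 * pdu X 0 0 + v.2 * pdw X 0 0,
        v.1 * pdu Y 0 0 + v.2 * pdw Y 0 0) := by
      have du : HasDerivAt (fun t : ℝ => Ψ (t, 0)) (D (1, 0)) 0 :=
        HasFDerivAt.comp_hasDerivAt (f := fun t : ℝ => (t, (0 : ℝ))) 0 dΨ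
          ((hasDerivAt_id 0).prodMk (hasDerivAt_const 0 0))
      have dw : HasDerivAt (fun t : ℝ => Ψ (0, t)) (D (0, 1)) 0 :=
        HasFDerivAt.comp_hasDerivAt (f := fun t : ℝ => ((0 : ℝ), t)) 0 dΨ
          ((hasDerivAt_const 0 0).prodMk (hasDerivAt_id 0))
      have eu : D (1, 0) = (pdu X 0 0, pdu Y 0 0) :=
        du.unique ((hX.hasDerivAt_pdu 0 0).prodMk (hY.hasDerivAt_pdu 0 0))
      have ew : D (0, 1) = (pdw X 0 0, pdw Y 0 0) :=
        dw.unique ((hX.hasDerivAt_pdw 0 0).prodMk (hY.hasDerivAt_pdw 0 0))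
      intro v
      have : v = v.1 • ((1, 0) : ℝ × ℝ) + v.2 • ((0, 1) : ℝ × ℝ) := by ext <;> simp
      conv_lhs => rw [this, map_add, map_smul, map_smul, eu, ew]
      ext <;> simp
    have h₁ : D (R (1, 0)) = (1, 0) := DFunLike.congr_fun hinv (1, 0)
    have h₂ : D (R (0, 1)) = (0, 1) := DFunLike.congr_fun hinv (0, 1)
    rw [hD, Prod.mk.injEq] at h₁ h₂
    obtain ⟨a₁, a₂⟩ := h₁
    obtain ⟨b₁, b₂⟩ := h₂
    intro hz
    have : (1 : ℝ) = (pdu X 0 0 * pdw Y 0 0 - pdw X 0 0 * pdu Y 0 0) *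
        ((R (1, 0)).1 * (R (0, 1)).2 - (R (1, 0)).2 * (R (0, 1)).1) := by
      linear_combination a₂ * ((R (0, 1)).1 * pdu X 0 0 + (R (0, 1)).2 * pdw X 0 0) - b₂ -
        a₁ * ((R (0, 1)).1 * pdu Y 0 0 + (R (0, 1)).2 * pdw Y 0 0)
    rw [hz, zero_mul] at this
    exact one_ne_zero this
  have one_var : ∀ x y : ℝ → ℝ, ContDiff ℝ (⊤ : ℕ∞) x → ContDiff ℝ (⊤ : ℕ∞) y → x 0 = 0 →
      y 0 = 0 → ∀ c : ℝ,
      iteratedDeriv 2 (fun t => c + ε₁ * x t ^ 2 + ε₂ * y t ^ 3) 0 = 2 * ε₁ * deriv x 0 ^ 2 ∧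
      (deriv x 0 = 0 → iteratedDeriv 3 (fun t => c + ε₁ * x t ^ 2 + ε₂ * y t ^ 3) 0 =
        6 * ε₂ * deriv y 0 ^ 3) := by
    intro x y hx hy hx0 hy0 c
    have hd : ∀ {z : ℝ → ℝ}, ContDiff ℝ (⊤ : ℕ∞) z → ∀ k t,
        HasDerivAt (iteratedDeriv k z) (iteratedDeriv (k + 1) z t) t := fun hz k t => by
      rw [iteratedDeriv_succ]
      exact (hz.differentiable_iteratedDeriv k
        (by exact_mod_cast ENat.natCast_lt_top k) t).hasDerivAt
    have e₁ : iteratedDeriv 1 (fun t => c + ε₁ * x t ^ 2 + ε₂ * y t ^ 3) = fun t =>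
        2 * ε₁ * (x t * iteratedDeriv 1 x t) + 3 * ε₂ * (y t ^ 2 * iteratedDeriv 1 y t) := by
      funext t
      rw [iteratedDeriv_one]
      have := ((((hd hx 0 t).pow 2).const_mul ε₁).const_add c).add
        (((hd hy 0 t).pow 3).const_mul ε₂)
      simp only [iteratedDeriv_zero] at this
      refine this.deriv.trans ?_
      push_cast
      ring
    have e₂ : iteratedDeriv 2 (fun t => c + ε₁ * x t ^ 2 + ε₂ * y t ^ 3) = fun t =>
        2 * ε₁ * (iteratedDeriv 1 x t ^ 2 + x t * iteratedDeriv 2 x t) +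
        3 * ε₂ * (2 * y t * iteratedDeriv 1 y t ^ 2 + y t ^ 2 * iteratedDeriv 2 y t) := by
      funext t
      rw [iteratedDeriv_succ, e₁]
      have := (((hd hx 0 t).mul (hd hx 1 t)).const_mul (2 * ε₁)).add
        ((((hd hy 0 t).pow 2).mul (hd hy 1 t)).const_mul (3 * ε₂))
      simp only [iteratedDeriv_zero] at this
      refine this.deriv.trans ?_
      simp only [Pi.pow_apply]
      push_cast
      ring
    constructor
    · rw [e₂]
      simp only [hx0, hy0, iteratedDeriv_one]
      ring
    · intro hx1
      rw [iteratedDeriv_succ, e₂]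
      have := ((((hd hx 1 0).pow 2).add ((hd hx 0 0).mul (hd hx 2 0))).const_mul (2 * ε₁)).add
        (((((hd hy 0 0).const_mul 2).mul ((hd hy 1 0).pow 2)).add
          (((hd hy 0 0).pow 2).mul (hd hy 2 0))).const_mul (3 * ε₂))
      simp only [iteratedDeriv_zero] at this
      refine this.deriv.trans ?_
      simp only [zero_add, iteratedDeriv_one, hx0, hy0, hx1, Pi.pow_apply]
      push_cast
      ring
  have hne : ∀ {ε : ℝ}, (ε = 1 ∨ ε = -1) → ε ≠ 0 := by
    rintro ε (rfl | rfl) <;> norm_num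
  have hu := one_var (fun t => X t 0) (fun t => Y t 0) (hX.comp_fst 0) (hY.comp_fst 0) hX0 hY0
    (h 0 0)
  have hw := one_var (X 0) (Y 0) (hX.comp_snd 0) (hY.comp_snd 0) hX0 hY0 (h 0 0)
  refine ⟨ε₁, ε₂, pdu X 0 0, pdw X 0 0, pdu Y 0 0, pdw Y 0 0, hne hε₁, hne hε₂, hdet, ?_, ?_, ?_,
    fun hx => ?_, fun hx => ?_⟩
  · rw [hpd, pd_iteratedDeriv_fst]
    exact hu.1
  · rw [hpd]
    have e : (fun t => pdw (fun u w => h 0 0 + ε₁ * X u w ^ 2 + ε₂ * Y u w ^ 3) t 0) = fun t =>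
        2 * ε₁ * (X t 0 * pdw X t 0) + 3 * ε₂ * (Y t 0 ^ 2 * pdw Y t 0) := by
      funext t
      have := ((((hX.hasDerivAt_pdw t 0).pow 2).const_mul ε₁).const_add (h 0 0)).add
        (((hY.hasDerivAt_pdw t 0).pow 3).const_mul ε₂)
      refine this.deriv.trans ?_
      push_cast
      ring
    change deriv (fun t => pdw (fun u w => h 0 0 + ε₁ * X u w ^ 2 + ε₂ * Y u w ^ 3) t 0) 0 = _
    rw [e]
    have := (((hX.hasDerivAt_pdu 0 0).mul (hX.smooth_pdw.hasDerivAt_pdu 0 0)).const_mul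
      (2 * ε₁)).add ((((hY.hasDerivAt_pdu 0 0).pow 2).mul
        (hY.smooth_pdw.hasDerivAt_pdu 0 0)).const_mul (3 * ε₂))
    refine this.deriv.trans ?_
    simp only [hX0, hY0, Pi.pow_apply]
    push_cast
    ring
  · rw [hpd, pd_iteratedDeriv_snd]
    exact hw.1
  · rw [hpd, pd_iteratedDeriv_fst]
    exact hu.2 hx
  · rw [hpd, pd_iteratedDeriv_snd]
    exact hw.2 hx

/-- `h_{ν₀}` has an `A₂` singularity at the origin iff (2a) or (2b) holds. -/
theorem height_A2_iff (p q : ℝ → ℝ → ℝ) (b : ℕ → ℝ) (a : ℕ → ℕ → ℝ)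
    (hNF : NormalFormN 4 p q b a) (y₀ z₀ : ℝ)
    (hunit : (0 : ℝ) ^ 2 + y₀ ^ 2 + z₀ ^ 2 = 1) :
    HasAkSingAt (hgt p q (0, y₀, z₀)) 2 ↔
      ((b 2 * y₀ + a 2 0 * z₀ = 0 ∧ y₀ ≠ 0 ∧ b 3 * y₀ + a 3 0 * z₀ ≠ 0) ∨
        (y₀ = 0 ∧ a 2 0 ≠ 0 ∧ a 0 3 ≠ 0)) := by
  obtain ⟨hp, hq, -, -, p10, p01, q10, q01, p02, pi0, pij, qij, a11, a02⟩ := hNF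
  have hp : Smooth₂ p := hp
  have hq : Smooth₂ q := hq
  have hh : hgt p q (0, y₀, z₀) = fun u w => y₀ * p u w + z₀ * q u w := by
    funext u w
    simp only [hgt, dot3, gmap]
    ring
  have hs : Smooth₂ (hgt p q (0, y₀, z₀)) := hh ▸ hp.linear_comb hq y₀ z₀
  have hpd : ∀ i j, pd i j (hgt p q (0, y₀, z₀)) 0 0 =
      y₀ * pd i j p 0 0 + z₀ * pd i j q 0 0 := fun i j => by
    rw [hh, hp.pd_linear_comb hq]
  have h10 : pd 1 0 (hgt p q (0, y₀, z₀)) 0 0 = 0 := by rw [hpd, p10, q10]; ring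
  have h01 : pd 0 1 (hgt p q (0, y₀, z₀)) 0 0 = 0 := by rw [hpd, p01, q01]; ring
  have h20 : pd 2 0 (hgt p q (0, y₀, z₀)) 0 0 = b 2 * y₀ + a 2 0 * z₀ := by
    rw [hpd, pi0 2 (by norm_num) (by norm_num), qij 2 0 (by norm_num) (by norm_num)]; ring
  have h11 : pd 1 1 (hgt p q (0, y₀, z₀)) 0 0 = 0 := by
    rw [hpd, pij 1 1 (by norm_num) (by norm_num) (by norm_num) (by norm_num),
      qij 1 1 (by norm_num) (by norm_num), a11]; ring
  have h02 : pd 0 2 (hgt p q (0, y₀, z₀)) 0 0 = y₀ := by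
    rw [hpd, p02, qij 0 2 (by norm_num) (by norm_num), a02]; ring
  have h30 : pd 3 0 (hgt p q (0, y₀, z₀)) 0 0 = b 3 * y₀ + a 3 0 * z₀ := by
    rw [hpd, pi0 3 (by norm_num) (by norm_num), qij 3 0 (by norm_num) (by norm_num)]; ring
  have h03 : pd 0 3 (hgt p q (0, y₀, z₀)) 0 0 = a 0 3 * z₀ := by
    rw [hpd, pij 0 3 (by norm_num) (by norm_num) (by norm_num) (by norm_num),
      qij 0 3 (by norm_num) (by norm_num)]; ring
  constructor
  · intro H
    obtain ⟨ε₁, ε₂, xu, xw, yu, yw, hε₁, hε₂, hdet, e20, e11, e02, e30, e03⟩ := H.exists_pd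
    rw [h20] at e20
    rw [h11] at e11
    rw [h02] at e02
    rw [h30] at e30
    rw [h03] at e03
    have hx : xu = 0 ∨ xw = 0 := by simpa [hε₁] using e11.symm
    rcases hx with rfl | rfl
    · have hxw : xw ≠ 0 := by rintro rfl; simp at hdet
      have hyu : yu ≠ 0 := by rintro rfl; simp at hdet
      refine Or.inl ⟨by simpa using e20, by rw [e02]; positivity, by rw [e30 rfl]; positivity⟩
    · have hxu : xu ≠ 0 := by rintro rfl; simp at hdet
      have hyw : yw ≠ 0 := by rintro rfl; simp at hdet
      have hy : y₀ = 0 := by simpa using e02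
      refine Or.inr ⟨hy, left_ne_zero_of_mul (b := z₀) ?_, left_ne_zero_of_mul (b := z₀) ?_⟩
      · rw [hy, mul_zero, zero_add] at e20
        rw [e20]
        positivity
      · rw [e03 rfl]
        positivity
  · rintro (⟨hA, hy, hB⟩ | ⟨rfl, hA, hB⟩)
    · exact hasAkSingAt_two_of_pd hs h10 h01 (h20.trans hA) h11 (h02.trans_ne hy)
        (h30.trans_ne hB)
    · have hz : z₀ ≠ 0 := by rintro rfl; norm_num at hunit
      refine HasAkSingAt.of_swap (hasAkSingAt_two_of_pd hs.swap ?_ ?_ ?_ ?_ ?_ ?_)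
      · rw [pd_fst_swap, h01]
      · rw [pd_snd_swap, h10]
      · rw [pd_fst_swap, h02]
      · rw [pd_one_one_swap hs, h11]
      · rw [pd_snd_swap, h20]
        simp [hA, hz]
      · rw [pd_fst_swap, h03]
        exact mul_ne_zero hB hz
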